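/- Let G = { P ∈ GL₃(ℂ) : for every i ∈ {1,…,18} there exist j ∈ {1,…,18} and k ∈ {0,1,2} with P·mᵢ·P⁻¹ = ζᵏ·mⱼ }, and let Ḡ be its image in PGL₃(ℂ) = GL₃(ℂ)/ℂ×. Then Ḡ has a normal subgroup N isomorphic to (ℤ/3ℤ)² such that the quotient Ḡ/N is isomorphic to SL(2,𝔽₃), and this extension splits; i.e., Ḡ ≅ (ℤ/3ℤ)² ⋊ SL(2,𝔽₃). -/

import Mathlib

open Matrix

noncomputable def ζ : ℂ := Complex.exp (2 * Real.pi * Complex.I / 3)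

noncomputable def a : ℂ := (((-((2 : ℝ) ^ (-(1/3 : ℝ)))) : ℝ) : ℂ)

noncomputable def m : Fin 18 → Matrix (Fin 3) (Fin 3) ℂ :=
  ![!![1, -1, 0; -1, 1, 0; 0, 0, 0],
    !![0, 0, 0; 0, 1, -ζ; 0, -ζ^2, 1],
    !![1, 0, -ζ; 0, 0, 0; -ζ^2, 0, 1],
    !![0, 0, 0; 0, 1, -ζ^2; 0, -ζ, 1],
    !![1, 0, -1; 0, 0, 0; -1, 0, 1],
    !![1, -ζ, 0; -ζ^2, 1, 0; 0, 0, 0],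
    !![1, 0, -ζ^2; 0, 0, 0; -ζ, 0, 1],
    !![1, -ζ^2, 0; -ζ, 1, 0; 0, 0, 0],
    !![0, 0, 0; 0, 1, -1; 0, -1, 1],
    a • (1 : Matrix (Fin 3) (Fin 3) ℂ),
    !![0, 1, 0; 0, 0, ζ; ζ^2, 0, 0],
    !![0, 0, 1; ζ^2, 0, 0; 0, ζ, 0],
    !![0, 1, 0; 0, 0, ζ^2; ζ, 0, 0],
    !![0, 0, 1; 1, 0, 0; 0, 1, 0],
    !![1, 0, 0; 0, ζ, 0; 0, 0, ζ^2],
    !![0, 0, 1; ζ, 0, 0; 0, ζ^2, 0],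
    !![1, 0, 0; 0, ζ^2, 0; 0, 0, ζ],
    !![0, 1, 0; 0, 0, 1; 1, 0, 0]]

/-- P ∈ GL₃(ℂ) is a symmetry of the decomposition if conjugation by P permutes
the summands mᵢ up to powers of ζ. -/
def SymmCond (P : GL (Fin 3) ℂ) : Prop :=
  ∀ i : Fin 18, ∃ (j : Fin 18) (k : Fin 3),
    (P : Matrix (Fin 3) (Fin 3) ℂ) * m i * ((P⁻¹ : GL (Fin 3) ℂ) : Matrix (Fin 3) (Fin 3) ℂ)
      = ζ ^ (k : ℕ) • m j

/-- The discrete phase space `𝔽₃²`. -/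
abbrev PhaseSpace : Type := ZMod 3 × ZMod 3

/-- The standard additive character `k ↦ ζ ^ k` of `ZMod 3`. -/
noncomputable abbrev χ : AddChar (ZMod 3) ℂ := ZMod.stdAddChar

theorem χ_natCast (k : ℕ) : χ (k : ZMod 3) = ζ ^ k := by
  have := ZMod.stdAddChar_coe (N := 3) (k : ℤ)
  push_cast at this
  rw [this, ζ, ← Complex.exp_nat_mul]
  congr 1
  ring

theorem χ_zero : χ 0 = 1 := AddChar.map_zero_eq_one _

theorem χ_one : χ 1 = ζ := by simpa using χ_natCast 1

theorem χ_two : χ 2 = ζ ^ 2 := by simpa using χ_natCast 2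

theorem χ_ne_zero (k : ZMod 3) : χ k ≠ 0 := by
  intro h
  have := AddChar.map_add_eq_mul χ k (-k)
  simp [h] at this

theorem ζ_cube : ζ ^ 3 = 1 := by
  rw [← χ_natCast 3]; exact χ_zero

theorem ζ_sum : 1 + ζ + ζ ^ 2 = 0 := by
  have h : ζ - 1 ≠ 0 := by
    rw [sub_ne_zero, ← χ_one, ← χ_zero]
    exact fun h => absurd (ZMod.injective_stdAddChar h) (by decide)
  apply mul_left_cancel₀ h
  linear_combination ζ_cube

/-- The symplectic form on the phase space. -/
def symp (u v : PhaseSpace) : ZMod 3 := u.1 * v.2 - u.2 * v.1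

/-- The Weyl operators with rows and columns indexed by `ZMod 3`, normalised so that
`D u * D v = χ (symp u v) • D (u + v)`. -/
noncomputable def weylZMod (v : PhaseSpace) : Matrix (ZMod 3) (ZMod 3) ℂ :=
  Matrix.of fun i j => if j = i + v.2 then χ (2 * v.1 * v.2 + v.1 * i) else 0

theorem three_eq_zero : (3 : ZMod 3) = 0 := by decide

theorem weylZMod_mul (u v : PhaseSpace) :
    weylZMod u * weylZMod v = χ (symp u v) • weylZMod (u + v) := by
  ext i k
  rw [Matrix.mul_apply, Finset.sum_eq_single (i + u.2) (by simp +contextual [weylZMod]) (by simp)]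
  simp only [weylZMod, Matrix.of_apply, Matrix.smul_apply, if_true, smul_eq_mul, mul_ite, mul_zero,
    ← AddChar.map_add_eq_mul, Prod.snd_add, add_assoc]
  congr 2
  simp only [symp, Prod.fst_add]
  linear_combination (-u.1 * v.2) * three_eq_zero

/-- The identification of matrix indices with `ZMod 3`. -/
def ι : Fin 3 ≃ ZMod 3 := (ZMod.finEquiv 3).toEquiv

theorem ι_zero : ι 0 = 0 := rfl

theorem ι_one : ι 1 = 1 := rfl

theorem ι_two : ι 2 = 2 := rfl

/-- The Weyl operators. -/
noncomputable def weyl (v : PhaseSpace) : Matrix (Fin 3) (Fin 3) ℂ := (weylZMod v).submatrix ι ι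

theorem weyl_mul (u v : PhaseSpace) :
    weyl u * weyl v = χ (symp u v) • weyl (u + v) := by
  rw [weyl, weyl, Matrix.submatrix_mul_equiv, weylZMod_mul, Matrix.submatrix_smul]
  rfl

theorem weyl_apply (v : PhaseSpace) (i j : Fin 3) :
    weyl v i j = if ι j = ι i + v.2 then χ (2 * v.1 * v.2 + v.1 * ι i) else 0 := rfl

theorem weyl_zero : weyl 0 = 1 := by
  ext i j
  simp [weyl_apply, Matrix.one_apply, eq_comm]

/-- The phase-space point operators. -/
noncomputable def pointOp (p : PhaseSpace) : Matrix (Fin 3) (Fin 3) ℂ :=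
  (1 / 3 : ℂ) • ∑ v, χ (symp p v) • weyl v

theorem pointOp_apply (p : PhaseSpace) (i j : Fin 3) :
    pointOp p i j = if ι i + ι j + p.2 = 0 then χ (p.1 * (ι j - ι i)) else 0 := by
  have h : ∀ y : ZMod 3, (ι j = ι i + y) = (ι j - ι i = y) := fun y => by
    rw [eq_iff_iff, sub_eq_iff_eq_add']
  simp only [pointOp, weyl_apply, Fintype.sum_prod_type, mul_ite, mul_zero, h, Matrix.smul_apply,
    Matrix.sum_apply, Finset.sum_ite_eq, Finset.mem_univ, if_true, smul_eq_mul,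
    ← AddChar.map_add_eq_mul, symp]
  have hsum := AddChar.sum_mulShift (-(ι i + ι j + p.2)) (ZMod.isPrimitive_stdAddChar 3)
  have hterm : ∀ x : ZMod 3, χ (p.1 * (ι j - ι i) - p.2 * x +
      (2 * x * (ι j - ι i) + x * ι i)) =
        χ (p.1 * (ι j - ι i)) * χ (x * (-(ι i + ι j + p.2))) := fun x => by
    rw [← AddChar.map_add_eq_mul]
    congr 1
    linear_combination (x * ι j) * three_eq_zero
  simp only [hterm, ← Finset.mul_sum, hsum, neg_eq_zero]
  split_ifs <;> simp
  ring

/-- The points `p` such that `1 - pointOp p` are the summands `m 0, …, m 8`, in this order. -/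
def pointLabel : Fin 9 → PhaseSpace :=
  ![(0, 2), (1, 0), (2, 1), (2, 0), (0, 1), (1, 2), (1, 1), (2, 2), (0, 0)]

/-- The points `v` such that the summands `m 10, …, m 17` are multiples of `weyl v`. -/
def weylLabel : Fin 8 → PhaseSpace :=
  ![(1, 1), (2, 2), (2, 1), (0, 2), (1, 0), (1, 2), (2, 0), (0, 1)]

/-- The exponents of `ζ` in `m (10 + i)` relative to `weyl (weylLabel i)`. -/
def weylPhase : Fin 8 → ZMod 3 := ![1, 1, 2, 0, 0, 2, 0, 0]

theorem m_castLE (i : Fin 9) :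
    m (i.castLE (by decide)) = 1 - pointOp (pointLabel i) := by
  have h₁ : -1 = (2 : ZMod 3) := rfl
  have h₂ : -2 = (1 : ZMod 3) := rfl
  have h₃ : 1 - 2 = (2 : ZMod 3) := rfl
  have h₄ : 2 - 1 = (1 : ZMod 3) := rfl
  have h₅ : 2 * 2 = (1 : ZMod 3) := rfl
  ext a b
  rw [Matrix.sub_apply, pointOp_apply]
  fin_cases i <;> fin_cases a <;> fin_cases b <;>
    simp +decide [pointLabel, m, ι_zero, ι_one, ι_two, χ_one, χ_two, h₁, h₂, h₃, h₄, h₅]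

theorem m_natAdd (i : Fin 8) : m (i.natAdd 10) = χ (weylPhase i) • weyl (weylLabel i) := by
  have h₁ : 1 + 1 = (2 : ZMod 3) := rfl
  have h₂ : 1 + 2 = (0 : ZMod 3) := rfl
  have h₃ : 2 + 1 = (0 : ZMod 3) := rfl
  have h₄ : 2 + 2 = (1 : ZMod 3) := rfl
  have h₅ : 2 * 2 = (1 : ZMod 3) := rfl
  ext a b
  rw [Matrix.smul_apply, weyl_apply, smul_eq_mul, mul_ite, ← AddChar.map_add_eq_mul, mul_zero]
  fin_cases i <;> fin_cases a <;> fin_cases b <;>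
    simp +decide [weylLabel, weylPhase, m, ι_zero, ι_one, ι_two, χ_one, χ_two,
      h₁, h₂, h₃, h₄, h₅]

theorem weyl_eq_smul_weyl {u v : PhaseSpace} {k : ZMod 3} (h : weyl u = χ k • weyl v) :
    u = v ∧ k = 0 := by
  have key (i : Fin 3) (j : Fin 3) := congrFun (congrFun h i) j
  simp only [weyl_apply, Matrix.smul_apply, smul_eq_mul, mul_ite, mul_zero,
    ← AddChar.map_add_eq_mul] at key
  have h₂ : u.2 = v.2 := by
    have := key 0 (ι.symm u.2)
    simp only [Equiv.apply_symm_apply, ι_zero, zero_add, if_true] at this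
    by_contra hne
    rw [if_neg hne] at this
    exact χ_ne_zero _ this
  have key' (x : ZMod 3) : 2 * u.1 * u.2 + u.1 * x = k + (2 * v.1 * v.2 + v.1 * x) := by
    have := key (ι.symm x) (ι.symm (x + u.2))
    simp only [Equiv.apply_symm_apply, h₂, if_true] at this
    rw [h₂]
    exact ZMod.injective_stdAddChar this
  have k₀ := key' 0
  have k₁ := key' 1
  have h₁ : u.1 = v.1 := by linear_combination k₁ - k₀
  refine ⟨Prod.ext h₁ h₂, ?_⟩
  rw [h₁, h₂] at k₀
  linear_combination -k₀

theorem trace_weyl {v : PhaseSpace} (hv : v ≠ 0) : (weyl v).trace = 0 := by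
  obtain ⟨x, y⟩ := v
  by_cases hy : y = 0
  · subst hy
    have hx : x = 1 ∨ x = 2 := by revert x; decide
    have h₁ : 2 * 2 = (1 : ZMod 3) := rfl
    rcases hx with rfl | rfl <;>
      simp only [Matrix.trace_fin_three, weyl_apply, ι_zero, ι_one, ι_two, add_zero, mul_zero,
        mul_one, one_mul,
        zero_add, if_true, χ_zero, χ_one, χ_two, h₁] <;>
      linear_combination ζ_sum
  · simp [Matrix.trace_fin_three, weyl_apply, hy]

theorem trace_m_castLE (i : Fin 9) : (m (i.castLE (by decide))).trace = 2 := by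
  fin_cases i <;> simp [m, Matrix.trace, Fin.sum_univ_three] <;> norm_num

theorem a_ne_zero : a ≠ 0 := by
  simp [a]

theorem trace_m_nine : (m 9).trace ≠ 0 := by
  simp [m, a_ne_zero]

theorem eq_castLE_or_natAdd (i : Fin 18) :
    (∃ j : Fin 9, i = j.castLE (by decide)) ∨ i = 9 ∨ ∃ j : Fin 8, i = j.natAdd 10 := by
  revert i; decide

theorem exists_natAdd_of_trace_eq_zero {i : Fin 18} (h : (m i).trace = 0) :
    ∃ j : Fin 8, i = j.natAdd 10 := by
  rcases eq_castLE_or_natAdd i with ⟨j, rfl⟩ | rfl | hj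
  · simp [trace_m_castLE] at h
  · exact absurd h trace_m_nine
  · exact hj

theorem exists_pointLabel_eq (p : PhaseSpace) : ∃ i, pointLabel i = p := by
  revert p; decide

theorem exists_weylLabel_eq {v : PhaseSpace} (hv : v ≠ 0) : ∃ i, weylLabel i = v := by
  revert v; decide

theorem weylLabel_ne_zero (i : Fin 8) : weylLabel i ≠ 0 := by
  revert i; decide

local notation "SL₂" => Matrix.SpecialLinearGroup (Fin 2) (ZMod 3)

/-- The linear action of `SL(2, 𝔽₃)` on the phase space. -/
def act (S : SL₂) (v : PhaseSpace) : PhaseSpace :=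
  (S.1 0 0 * v.1 + S.1 0 1 * v.2, S.1 1 0 * v.1 + S.1 1 1 * v.2)

theorem act_one (v : PhaseSpace) : act 1 v = v := by
  simp [act]

theorem act_mul (S T : SL₂) (v : PhaseSpace) : act (S * T) v = act S (act T v) := by
  ext <;> simp [act, Matrix.mul_apply, Fin.sum_univ_two] <;> ring

theorem act_add (S : SL₂) (u v : PhaseSpace) : act S (u + v) = act S u + act S v := by
  ext <;> simp [act] <;> ring

theorem symp_act (S : SL₂) (u v : PhaseSpace) : symp (act S u) (act S v) = symp u v := by
  have h := S.2
  rw [Matrix.det_fin_two] at h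
  simp only [symp, act]
  linear_combination (u.1 * v.2 - u.2 * v.1) * h

theorem symp_add_left (u v w : PhaseSpace) : symp (u + v) w = symp u w + symp v w := by
  simp only [symp, Prod.fst_add, Prod.snd_add]; ring

/-- The action of `SL(2, 𝔽₃)` on the phase space by group automorphisms. -/
def actHom : SL₂ →* MulAut (Multiplicative PhaseSpace) where
  toFun S :=
    { toFun := fun v => .ofAdd (act S v.toAdd)
      invFun := fun v => .ofAdd (act S⁻¹ v.toAdd)
      left_inv := fun v => by simp [← act_mul, act_one]
      right_inv := fun v => by simp [← act_mul, act_one]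
      map_mul' := fun u v => by simp [act_add] }
  map_one' := by ext v : 1; simp [act_one]
  map_mul' S T := by ext v : 1; simp [act_mul]

/-- The affine symplectic group of the phase space. -/
abbrev AffineSL : Type := Multiplicative PhaseSpace ⋊[actHom] SL₂

/-- `P` acts on the Weyl operators by conjugation through the affine symplectic map `h`. -/
def Implements (P : Matrix (Fin 3) (Fin 3) ℂ) (h : AffineSL) : Prop :=
  ∀ v, P * weyl v =
    χ (symp h.left.toAdd (act h.right v)) • (weyl (act h.right v) * P)

theorem implements_one : Implements 1 1 := fun v => by
  simp [act_one, symp]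

theorem Implements.mul {P Q : Matrix (Fin 3) (Fin 3) ℂ} {g h : AffineSL}
    (hP : Implements P g) (hQ : Implements Q h) : Implements (P * Q) (g * h) := fun v => by
  have : (g * h).left.toAdd = g.left.toAdd + act g.right h.left.toAdd := rfl
  rw [Matrix.mul_assoc, hQ, Matrix.mul_smul, ← Matrix.mul_assoc, hP, this,
    SemidirectProduct.mul_right, act_mul, symp_add_left, symp_act, AddChar.map_add_eq_mul,
    Matrix.smul_mul, smul_smul, mul_comm (χ _), Matrix.mul_assoc]

theorem Implements.inv {P : GL (Fin 3) ℂ} {h : AffineSL} (hP : Implements P h) :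
    Implements (P⁻¹ : GL (Fin 3) ℂ) h⁻¹ := fun v => by
  have hv := hP (act h.right⁻¹ v)
  rw [← act_mul, mul_inv_cancel, act_one] at hv
  have hs : symp h⁻¹.left.toAdd (act h.right⁻¹ v) = - symp h.left.toAdd v := by
    have : h⁻¹.left.toAdd = act h.right⁻¹ (-h.left.toAdd) := rfl
    rw [this, symp_act]
    simp only [symp, Prod.fst_neg, Prod.snd_neg]; ring
  rw [SemidirectProduct.inv_right, hs]
  have hP₁ : (P : Matrix (Fin 3) (Fin 3) ℂ) * (P⁻¹ : GL (Fin 3) ℂ) = 1 := by simp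
  have hP₂ : ((P⁻¹ : GL (Fin 3) ℂ) : Matrix (Fin 3) (Fin 3) ℂ) * P = 1 := by simp
  have hχ : χ (-symp h.left.toAdd v) * χ (symp h.left.toAdd v) = 1 := by
    rw [← AddChar.map_add_eq_mul, neg_add_cancel, χ_zero]
  calc _ = χ (-symp h.left.toAdd v) • ((P⁻¹ : GL (Fin 3) ℂ) *
      (χ (symp h.left.toAdd v) • (weyl v * P)) * (P⁻¹ : GL (Fin 3) ℂ)) := by
        rw [Matrix.mul_smul, Matrix.smul_mul, smul_smul, hχ, one_smul, Matrix.mul_assoc,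
          Matrix.mul_assoc, hP₁, Matrix.mul_one]
    _ = _ := by
      rw [← hv, ← Matrix.mul_assoc, hP₂, Matrix.one_mul]

theorem conj_eq_iff {P : GL (Fin 3) ℂ} {A B : Matrix (Fin 3) (Fin 3) ℂ} :
    (P : Matrix (Fin 3) (Fin 3) ℂ) * A * ((P⁻¹ : GL (Fin 3) ℂ) : Matrix (Fin 3) (Fin 3) ℂ) = B ↔
      (P : Matrix (Fin 3) (Fin 3) ℂ) * A = B * P :=
  Units.mul_inv_eq_iff_eq_mul P

/-- An affine symplectic map as a map of the phase space. -/
def affineAct (h : AffineSL) (p : PhaseSpace) : PhaseSpace := h.left.toAdd + act h.right p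

theorem act_bijective (S : SL₂) : Function.Bijective (act S) :=
  Function.bijective_iff_has_inverse.mpr ⟨act S⁻¹, fun v => by simp [← act_mul, act_one],
    fun v => by simp [← act_mul, act_one]⟩

theorem Implements.mul_pointOp {P : Matrix (Fin 3) (Fin 3) ℂ} {h : AffineSL}
    (hP : Implements P h) (p : PhaseSpace) : P * pointOp p = pointOp (affineAct h p) * P := by
  simp only [pointOp, Matrix.mul_smul, Matrix.smul_mul, Matrix.mul_sum, Matrix.sum_mul, hP _,
    smul_smul, ← AddChar.map_add_eq_mul]
  congr 1
  refine Fintype.sum_bijective _ (act_bijective h.right) _ _ fun v => ?_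
  rw [affineAct, symp_add_left, symp_act, add_comm]

theorem act_ne_zero (S : SL₂) {v : PhaseSpace} (hv : v ≠ 0) : act S v ≠ 0 := by
  have h0 : act S 0 = 0 := by simp [act]
  rw [← h0]
  exact (act_bijective S).injective.ne hv

theorem χ_eq_ζ_pow (k : ZMod 3) : ∃ l : Fin 3, χ k = ζ ^ (l : ℕ) :=
  ⟨ι.symm k, by rw [← χ_natCast]; congr 1; revert k; decide⟩

theorem Implements.symmCond {P : GL (Fin 3) ℂ} {h : AffineSL} (hP : Implements P h) :
    SymmCond P := by
  intro i
  simp only [conj_eq_iff]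
  rcases eq_castLE_or_natAdd i with ⟨i, rfl⟩ | rfl | ⟨i, rfl⟩
  · obtain ⟨j, hj⟩ := exists_pointLabel_eq (affineAct h (pointLabel i))
    refine ⟨j.castLE (by decide), 0, ?_⟩
    simp [m_castLE, hj, Matrix.mul_sub, Matrix.sub_mul, hP.mul_pointOp]
  · exact ⟨9, 0, by simp [m]⟩
  · obtain ⟨j, hj⟩ := exists_weylLabel_eq (act_ne_zero h.right (weylLabel_ne_zero i))
    obtain ⟨l, hl⟩ := χ_eq_ζ_pow
      (weylPhase i + symp h.left.toAdd (weylLabel j) - weylPhase j)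
    refine ⟨j.natAdd 10, l, ?_⟩
    rw [← hl, m_natAdd, m_natAdd, Matrix.mul_smul, hP, ← hj, smul_smul, smul_smul,
      ← AddChar.map_add_eq_mul, ← AddChar.map_add_eq_mul, sub_add_cancel, Matrix.smul_mul]

theorem exists_mul_weyl_of_symmCond {P : GL (Fin 3) ℂ} (hP : SymmCond P) (v : PhaseSpace) :
    ∃ (w : PhaseSpace) (k : ZMod 3),
      (P : Matrix (Fin 3) (Fin 3) ℂ) * weyl v = χ k • (weyl w * P) := by
  by_cases hv : v = 0
  · exact ⟨0, 0, by simp [hv, weyl_zero]⟩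
  obtain ⟨i, rfl⟩ := exists_weylLabel_eq hv
  obtain ⟨j, k, hjk⟩ := hP (i.natAdd 10)
  rw [← χ_natCast] at hjk
  have htr : (m j).trace = 0 := by
    have := congrArg Matrix.trace hjk
    rw [Matrix.trace_mul_cycle, Units.inv_mul, Matrix.one_mul, m_natAdd, Matrix.trace_smul,
      trace_weyl hv, smul_zero, Matrix.trace_smul] at this
    exact (smul_eq_zero.mp this.symm).resolve_left (χ_ne_zero _)
  obtain ⟨j, rfl⟩ := exists_natAdd_of_trace_eq_zero htr
  rw [conj_eq_iff, m_natAdd, m_natAdd, Matrix.mul_smul, smul_smul, Matrix.smul_mul,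
    ← AddChar.map_add_eq_mul] at hjk
  refine ⟨weylLabel j, -weylPhase i + (((k : ℕ) : ZMod 3) + weylPhase j), ?_⟩
  rw [AddChar.map_add_eq_mul, mul_smul, ← hjk, smul_smul, ← AddChar.map_add_eq_mul,
    neg_add_cancel, χ_zero, one_smul]

theorem exists_implements_of_symmCond {P : GL (Fin 3) ℂ} (hP : SymmCond P) :
    ∃ h, Implements P h := by
  choose s κ hs using exists_mul_weyl_of_symmCond hP
  have key (u v : PhaseSpace) : s (u + v) = s u + s v ∧
      symp u v + κ (u + v) = κ u + κ v + symp (s u) (s v) := by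
    have h₁ : (P : Matrix (Fin 3) (Fin 3) ℂ) * (weyl u * weyl v) =
        χ (symp u v + κ (u + v)) • (weyl (s (u + v)) * P) := by
      rw [weyl_mul, Matrix.mul_smul, hs, smul_smul, ← AddChar.map_add_eq_mul]
    have h₂ : (P : Matrix (Fin 3) (Fin 3) ℂ) * (weyl u * weyl v) =
        χ (κ u + κ v + symp (s u) (s v)) • (weyl (s u + s v) * P) := by
      rw [← Matrix.mul_assoc, hs, Matrix.smul_mul, Matrix.mul_assoc, hs, Matrix.mul_smul,
        ← Matrix.mul_assoc, weyl_mul, Matrix.smul_mul, smul_smul, smul_smul,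
        ← AddChar.map_add_eq_mul, ← AddChar.map_add_eq_mul, add_assoc]
    rw [h₁, ← Matrix.smul_mul, ← Matrix.smul_mul, Units.mul_left_inj] at h₂
    have h₃ : weyl (s (u + v)) = χ (-(symp u v + κ (u + v)) +
        (κ u + κ v + symp (s u) (s v))) • weyl (s u + s v) := by
      rw [AddChar.map_add_eq_mul, mul_smul, ← h₂, smul_smul, ← AddChar.map_add_eq_mul,
        neg_add_cancel, χ_zero, one_smul]
    obtain ⟨h₄, h₅⟩ := weyl_eq_smul_weyl h₃
    exact ⟨h₄, by linear_combination -h₅⟩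
  have hsymp (u v : PhaseSpace) : symp (s u) (s v) = symp u v := by
    have h₁ := (key u v).2
    have h₂ := (key v u).2
    rw [add_comm v u] at h₂
    simp only [symp] at h₁ h₂ ⊢
    linear_combination (norm := ring_nf) h₁ - h₂ + (symp (s u) (s v) - symp u v) * three_eq_zero
    simp only [symp]; ring
  have hκ (u v : PhaseSpace) : κ (u + v) = κ u + κ v := by
    have := (key u v).2
    rw [hsymp] at this
    linear_combination this
  let S : SL₂ := ⟨!![(s (1, 0)).1, (s (0, 1)).1; (s (1, 0)).2, (s (0, 1)).2], by
    have := hsymp (1, 0) (0, 1)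
    simp only [symp] at this
    rw [Matrix.det_fin_two_of]
    linear_combination this⟩
  have hbasis {A : Type} [AddCommGroup A] [Module (ZMod 3) A] (f : PhaseSpace → A)
      (hf : ∀ u v, f (u + v) = f u + f v) (v : PhaseSpace) :
      f v = v.1 • f (1, 0) + v.2 • f (0, 1) := by
    let g : PhaseSpace →ₗ[ZMod 3] A := (AddMonoidHom.mk' f hf).toZModLinearMap 3
    have : v = v.1 • (1, 0) + v.2 • (0, 1) := by ext <;> simp
    have hg := congrArg g this
    rwa [map_add, map_smul, map_smul] at hg
  have hS (v : PhaseSpace) : s v = act S v := by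
    rw [hbasis s (fun u v => (key u v).1) v]
    ext <;> simp [S, act, mul_comm]
  obtain ⟨c, hc⟩ : ∃ c, ∀ v, κ v = symp c (act S v) := by
    refine ⟨act S (κ (0, 1), -κ (1, 0)), fun v => ?_⟩
    rw [symp_act, hbasis κ hκ v]
    simp only [symp, smul_eq_mul]; ring
  refine ⟨⟨.ofAdd c, S⟩, fun v => ?_⟩
  rw [hs, hS, hc]
  rfl

theorem implements_weyl (b : PhaseSpace) :
    Implements (weyl (b + b)) (SemidirectProduct.inl (.ofAdd b)) := fun v => by
  simp only [SemidirectProduct.left_inl, SemidirectProduct.right_inl, act_one, toAdd_ofAdd,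
    weyl_mul, smul_smul, ← AddChar.map_add_eq_mul, add_comm v]
  congr 2
  simp only [symp, Prod.fst_add, Prod.snd_add]
  linear_combination (b.1 * v.2 - b.2 * v.1) * three_eq_zero

/-- The matrix `!![1, x; 0, 1]`. -/
def upper (x : ZMod 3) : SL₂ := ⟨!![1, x; 0, 1], by simp⟩

/-- The matrix `!![0, -1; 1, 0]`. -/
def quarterTurn : SL₂ := ⟨!![0, -1; 1, 0], by simp⟩

theorem act_upper (x : ZMod 3) (v : PhaseSpace) : act (upper x) v = (v.1 + x * v.2, v.2) := by
  simp [act, upper]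

theorem act_quarterTurn (v : PhaseSpace) : act quarterTurn v = (-v.2, v.1) := by
  simp [act, quarterTurn]

theorem implements_inr {P : Matrix (Fin 3) (Fin 3) ℂ} {S : SL₂} :
    Implements P (SemidirectProduct.inr S) ↔ ∀ v, P * weyl v = weyl (act S v) * P := by
  refine forall_congr' fun v => ?_
  simp [symp]

/-- The diagonal matrix of a quadratic character, implementing a transvection. -/
noncomputable def chirp (x : ZMod 3) : Matrix (Fin 3) (Fin 3) ℂ :=
  Matrix.diagonal fun i => χ (x * ι i ^ 2)

/-- The matrix of the Fourier transform on `ZMod 3` (for `x = 1`), or of its inverse up to a scalar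
(for `x = -1`). -/
noncomputable def fourierMatrix (x : ZMod 3) : Matrix (Fin 3) (Fin 3) ℂ :=
  Matrix.of fun i j => χ (x * ι i * ι j)

theorem implements_chirp (x : ZMod 3) :
    Implements (chirp x) (SemidirectProduct.inr (upper x)) := by
  refine implements_inr.mpr fun v => ?_
  ext i j
  simp only [chirp, Matrix.diagonal_mul, Matrix.mul_diagonal, weyl_apply, act_upper, mul_ite,
    ite_mul, mul_zero, zero_mul, ← AddChar.map_add_eq_mul]
  split_ifs with h
  · rw [h]
    congr 1
    linear_combination (-x * v.2 ^ 2 - x * v.2 * ι i) * three_eq_zero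
  · rfl

theorem implements_fourierMatrix :
    Implements (fourierMatrix 1) (SemidirectProduct.inr quarterTurn) := by
  refine implements_inr.mpr fun v => ?_
  ext i k
  rw [Matrix.mul_apply, Matrix.mul_apply, Finset.sum_eq_single (ι.symm (ι k - v.2)),
    Finset.sum_eq_single (ι.symm (ι i + v.1))]
  · simp only [fourierMatrix, weyl_apply, act_quarterTurn, Matrix.of_apply,
      Equiv.apply_symm_apply, sub_add_cancel, if_true, ← AddChar.map_add_eq_mul]
    congr 1
    linear_combination (v.1 * v.2) * three_eq_zero
  · intro j _ hj
    rw [weyl_apply, act_quarterTurn, if_neg, zero_mul]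
    exact fun h => hj (by simp [← h])
  · simp
  · intro j _ hj
    rw [weyl_apply, if_neg, mul_zero]
    exact fun h => hj (by simp [h])
  · simp

theorem chirp_mul_chirp_neg (x : ZMod 3) : chirp x * chirp (-x) = 1 := by
  simp [chirp, ← AddChar.map_add_eq_mul]

theorem fourierMatrix_mul :
    fourierMatrix 1 * ((1 / 3 : ℂ) • fourierMatrix (-1)) = 1 := by
  ext i k
  have hsum := AddChar.sum_mulShift (ι i - ι k) (ZMod.isPrimitive_stdAddChar 3)
  have h : ∑ j, fourierMatrix 1 i j * fourierMatrix (-1) j k = ∑ x, χ (x * (ι i - ι k)) := by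
    refine Fintype.sum_equiv ι _ _ fun j => ?_
    simp only [fourierMatrix, Matrix.of_apply, ← AddChar.map_add_eq_mul]
    congr 1
    ring
  rw [Matrix.mul_smul, Matrix.smul_apply, Matrix.mul_apply, h, hsum, Matrix.one_apply]
  by_cases hik : i = k <;> simp [hik, sub_eq_zero]

/-- The pairs of an invertible matrix and an affine symplectic map implemented by it. -/
noncomputable def implementingPairs : Subgroup (GL (Fin 3) ℂ × AffineSL) where
  carrier := {x | Implements x.1 x.2}
  one_mem' := implements_one
  mul_mem' := Implements.mul
  inv_mem' := Implements.inv

theorem mem_map_snd {P Q : Matrix (Fin 3) (Fin 3) ℂ} {h : AffineSL} (hPQ : P * Q = 1)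
    (hP : Implements P h) : h ∈ implementingPairs.map (MonoidHom.snd _ _) :=
  ⟨(⟨P, Q, hPQ, mul_eq_one_comm.mp hPQ⟩, h), hP, rfl⟩

theorem eq_top_of_upper_mem_of_quarterTurn_mem {W : Subgroup SL₂} (hu : ∀ x, upper x ∈ W)
    (hq : quarterTurn ∈ W) : W = ⊤ := by
  have key (S : SL₂) (hS : S.1 1 0 ≠ 0) : S ∈ W := by
    have hr : S.1 1 0 * S.1 1 0 = 1 := by
      generalize S.1 1 0 = r at hS; revert r; decide
    have hdet := S.2
    rw [Matrix.det_fin_two] at hdet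
    have : S = upper ((S.1 0 0 + 1) * S.1 1 0) * quarterTurn * upper (S.1 1 0) * quarterTurn *
        upper ((S.1 1 1 + 1) * S.1 1 0) := by
      refine Subtype.ext ?_
      rw [Matrix.SpecialLinearGroup.coe_mul, Matrix.SpecialLinearGroup.coe_mul,
        Matrix.SpecialLinearGroup.coe_mul, Matrix.SpecialLinearGroup.coe_mul]
      ext i j
      fin_cases i <;> fin_cases j <;>
        simp [upper, quarterTurn, Matrix.mul_apply, Fin.sum_univ_two]
      · linear_combination -(S.1 0 0 + 1) * hr
      · linear_combination -S.1 1 0 * hdet -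
          (S.1 0 1 + S.1 1 0 * (1 + S.1 0 0) * (1 + S.1 1 1)) * hr
      · linear_combination -(S.1 1 1 + 1) * hr
    rw [this]
    exact W.mul_mem (W.mul_mem (W.mul_mem (W.mul_mem (hu _) hq) (hu _)) hq) (hu _)
  refine eq_top_iff.mpr fun S _ => ?_
  by_cases hS : S.1 1 0 = 0
  · refine (W.mul_mem_cancel_left hq).mp (key _ fun h => ?_)
    have hdet := S.2
    rw [Matrix.det_fin_two, hS] at hdet
    rw [Matrix.SpecialLinearGroup.coe_mul] at h
    simp [quarterTurn, Matrix.mul_apply, Fin.sum_univ_two] at h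
    simp [h] at hdet
  · exact key S hS

theorem map_snd_implementingPairs : implementingPairs.map (MonoidHom.snd _ _) = ⊤ := by
  have hr : ∀ S, SemidirectProduct.inr S ∈ implementingPairs.map (MonoidHom.snd _ _) := by
    have : (implementingPairs.map (MonoidHom.snd _ _)).comap SemidirectProduct.inr = ⊤ :=
      eq_top_of_upper_mem_of_quarterTurn_mem
        (fun x => mem_map_snd (chirp_mul_chirp_neg x) (implements_chirp x))
        (mem_map_snd fourierMatrix_mul implements_fourierMatrix)
    intro S
    exact this.ge (Subgroup.mem_top S)
  have hl (b : Multiplicative PhaseSpace) :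
      SemidirectProduct.inl b ∈ implementingPairs.map (MonoidHom.snd _ _) := by
    refine mem_map_snd (Q := weyl (-(b.toAdd + b.toAdd))) ?_ (implements_weyl b.toAdd)
    have (u : PhaseSpace) : symp u (-u) = 0 := by
      simp only [symp, Prod.fst_neg, Prod.snd_neg]; ring
    rw [weyl_mul, add_neg_cancel, weyl_zero, this, χ_zero, one_smul]
  refine eq_top_iff.mpr fun h _ => ?_
  rw [← SemidirectProduct.inl_left_mul_inr_right h]
  exact mul_mem (hl _) (hr _)

theorem implements_one_iff {h : AffineSL} : Implements 1 h ↔ h = 1 := by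
  refine ⟨fun hP => ?_, fun h => h ▸ implements_one⟩
  have key (v : PhaseSpace) : act h.right v = v ∧ symp h.left.toAdd v = 0 := by
    have := hP v
    rw [Matrix.one_mul, Matrix.mul_one] at this
    obtain ⟨h₁, h₂⟩ := weyl_eq_smul_weyl this
    rw [← h₁] at h₂
    exact ⟨h₁.symm, h₂⟩
  have h₁ := (key (1, 0)).1
  have h₂ := (key (0, 1)).1
  have h₃ := (key (1, 0)).2
  have h₄ := (key (0, 1)).2
  simp [act, symp] at h₁ h₂ h₃ h₄
  refine SemidirectProduct.ext (Multiplicative.toAdd.injective (Prod.ext h₄ h₃)) ?_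
  ext i j
  fin_cases i <;> fin_cases j <;> simp [h₁, h₂]

theorem implements_smul {c : ℂ} (hc : c ≠ 0) {P : Matrix (Fin 3) (Fin 3) ℂ} {h : AffineSL} :
    Implements (c • P) h ↔ Implements P h := by
  refine forall_congr' fun v => ?_
  rw [Matrix.smul_mul, Matrix.mul_smul, smul_comm _ c, smul_right_inj hc]

theorem Implements.mem_center {P : GL (Fin 3) ℂ} (hP : Implements P 1) :
    P ∈ Subgroup.center (GL (Fin 3) ℂ) := by
  have hcomm (v : PhaseSpace) : (P : Matrix (Fin 3) (Fin 3) ℂ) * weyl v = weyl v * P := by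
    simpa [symp, act_one, χ_zero] using hP v
  refine Matrix.GeneralLinearGroup.mem_center_iff_val_mem_range_scalar.mpr ⟨P.1 0 0, ?_⟩
  have hoff (i j : Fin 3) (hij : i ≠ j) : P.1 i j = 0 := by
    have h := congrFun (congrFun (hcomm (1, 0)) i) j
    have hd : weyl (1, 0) = Matrix.diagonal fun i => χ (ι i) := by
      ext i j
      simp [weyl_apply, Matrix.diagonal_apply, eq_comm]
    rw [hd, Matrix.mul_diagonal, Matrix.diagonal_mul, mul_comm] at h
    exact (mul_eq_mul_right_iff.mp h).resolve_left
      fun h => hij (ι.injective (ZMod.injective_stdAddChar h)).symm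
  have hdiag (i j : Fin 3) (hij : ι j = ι i + 1) : P.1 i i = P.1 j j := by
    have h := congrFun (congrFun (hcomm (0, 1)) i) j
    rw [Matrix.mul_apply, Matrix.mul_apply, Finset.sum_eq_single i, Finset.sum_eq_single j] at h
    · simpa [weyl_apply, hij] using h
    · exact fun k _ hk => by rw [hoff k j hk, mul_zero]
    · simp
    · exact fun k _ hk => by rw [hoff i k hk.symm, zero_mul]
    · simp
  have h₁ := hdiag 0 1 rfl
  have h₂ := hdiag 1 2 rfl
  rw [Matrix.scalar_apply]
  ext i j
  by_cases hij : i = j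
  · subst hij
    rw [Matrix.diagonal_apply_eq]
    fin_cases i
    · rfl
    · exact h₁
    · exact h₁.trans h₂
  · rw [Matrix.diagonal_apply_ne _ hij, hoff i j hij]

theorem mem_center_iff_of_mem {x : GL (Fin 3) ℂ × AffineSL} (hx : x ∈ implementingPairs) :
    x.1 ∈ Subgroup.center (GL (Fin 3) ℂ) ↔ x.2 = 1 := by
  have hx : Implements x.1 x.2 := hx
  constructor
  · intro h
    obtain ⟨c, hc⟩ := Matrix.GeneralLinearGroup.mem_center_iff_val_mem_range_scalar.mp h
    have hc0 : c ≠ 0 := by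
      rintro rfl
      rw [map_zero] at hc
      exact x.1.ne_zero hc.symm
    rw [← hc, Matrix.scalar_apply, ← Matrix.smul_one_eq_diagonal, implements_smul hc0] at hx
    exact implements_one_iff.mp hx
  · intro h
    rw [h] at hx
    exact hx.mem_center

theorem exists_pgl_equiv : Nonempty
    (((implementingPairs.map (MonoidHom.fst _ _)).map
      (QuotientGroup.mk' (Subgroup.center (GL (Fin 3) ℂ)))) ≃* AffineSL) := by
  let f : implementingPairs →* AffineSL := (MonoidHom.snd _ _).comp implementingPairs.subtype
  have hf : Function.Surjective f := fun h => by
    obtain ⟨x, hx, rfl⟩ := map_snd_implementingPairs.ge (Subgroup.mem_top h)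
    exact ⟨⟨x, hx⟩, rfl⟩
  let g := ((QuotientGroup.mk' (Subgroup.center (GL (Fin 3) ℂ))).subgroupMap
    (implementingPairs.map (MonoidHom.fst _ _))).comp
      ((MonoidHom.fst _ _).subgroupMap implementingPairs)
  have hg : Function.Surjective g :=
    (MonoidHom.subgroupMap_surjective _ _).comp (MonoidHom.subgroupMap_surjective _ _)
  have hker : g.ker = f.ker := by
    ext x
    refine Iff.trans ?_ (mem_center_iff_of_mem x.2)
    rw [MonoidHom.mem_ker, Subtype.ext_iff]
    exact QuotientGroup.eq_one_iff _
  exact ⟨(QuotientGroup.quotientKerEquivOfSurjective g hg).symm.trans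
    ((QuotientGroup.quotientMulEquivOfEq hker).trans
      (QuotientGroup.quotientKerEquivOfSurjective f hf))⟩

theorem exists_normal_of_semidirectProduct {Γ A H : Type*} [Group Γ] [Group A] [Group H]
    {φ : H →* MulAut A} (E : Γ ≃* A ⋊[φ] H) :
    ∃ N : Subgroup Γ, N.Normal ∧ Nonempty (N ≃* A) ∧
      (∃ f : Γ →* H, Function.Surjective f ∧ f.ker = N) ∧
      ∃ φ : H →* MulAut A, Nonempty (Γ ≃* A ⋊[φ] H) := by
  let f := SemidirectProduct.rightHom.comp E.toMonoidHom
  let g := E.symm.toMonoidHom.comp SemidirectProduct.inl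
  have hg : Function.Injective g := E.symm.injective.comp SemidirectProduct.inl_injective
  have hfg : f.ker = g.range := by
    rw [MonoidHom.range_comp, SemidirectProduct.range_inl_eq_ker_rightHom,
      ← MonoidHom.comap_ker]
    exact (Subgroup.map_equiv_eq_comap_symm E.symm _).symm
  exact ⟨f.ker, f.normal_ker,
    ⟨(MulEquiv.subgroupCongr hfg).trans (MonoidHom.ofInjective hg).symm⟩,
    ⟨f, SemidirectProduct.rightHom_surjective.comp E.surjective, rfl⟩, φ, ⟨E⟩⟩

theorem mem_map_fst_implementingPairs {P : GL (Fin 3) ℂ} :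
    P ∈ implementingPairs.map (MonoidHom.fst _ _) ↔ SymmCond P := by
  refine ⟨?_, fun hP => ?_⟩
  · rintro ⟨x, hx, rfl⟩
    exact Implements.symmCond hx
  · obtain ⟨h, hh⟩ := exists_implements_of_symmCond hP
    exact ⟨(P, h), hh, rfl⟩

/-- The image Ḡ in PGL₃(ℂ) = GL₃(ℂ)/ℂ× of the group G of symmetries of the
decomposition has a normal subgroup N ≅ (ℤ/3ℤ)² with Ḡ/N ≅ SL(2,𝔽₃), and the
extension splits: Ḡ ≅ (ℤ/3ℤ)² ⋊ SL(2,𝔽₃). -/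
theorem pgl_symmetry_group_structure :
    ∃ G : Subgroup (GL (Fin 3) ℂ),
      (∀ P : GL (Fin 3) ℂ, P ∈ G ↔ SymmCond P) ∧
      ∃ N : Subgroup ↥(G.map (QuotientGroup.mk' (Subgroup.center (GL (Fin 3) ℂ)))),
        N.Normal ∧
        Nonempty (↥N ≃* Multiplicative (ZMod 3 × ZMod 3)) ∧
        (∃ f : ↥(G.map (QuotientGroup.mk' (Subgroup.center (GL (Fin 3) ℂ)))) →*
            Matrix.SpecialLinearGroup (Fin 2) (ZMod 3),
          Function.Surjective f ∧ f.ker = N) ∧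
        ∃ φ : Matrix.SpecialLinearGroup (Fin 2) (ZMod 3) →*
            MulAut (Multiplicative (ZMod 3 × ZMod 3)),
          Nonempty (↥(G.map (QuotientGroup.mk' (Subgroup.center (GL (Fin 3) ℂ)))) ≃*
            (Multiplicative (ZMod 3 × ZMod 3)) ⋊[φ]
              Matrix.SpecialLinearGroup (Fin 2) (ZMod 3)) := by
  obtain ⟨E⟩ := exists_pgl_equiv
  exact ⟨_, fun _ => mem_map_fst_implementingPairs, exists_normal_of_semidirectProduct E⟩
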